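/- Let q be a prime power, F_q the finite field with q elements, n ≥ 2, and let t be even with 2 ≤ t ≤ 2n − 2. Let A = (α_1,…,α_t) ∈ F_q^t be a nonzero vector whose first nonzero entry equals 1. Then the number of 2 × (2n) matrices G over F_q in RREF such that the first t columns of G form the 2 × t matrix with first row A and second row zero, and the two rows of G span a totally isotropic 2-dimensional subspace of F_q^{2n} for the form s, equals q^{2n−t−2} (q^{2n−t} − 1) / (q − 1). -/

import Mathlib

/-- A `2 × L` matrix over a field is in row reduced echelon form: both rows are
nonzero, the leading entry of each row is `1`, the pivot of the second row lies
strictly to the right of the pivot of the first row, and the entry of the first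
row in the pivot column of the second row is `0`. -/
def IsRREF2 {F : Type*} [Field F] {L : ℕ} (M : Matrix (Fin 2) (Fin L) F) : Prop :=
  ∃ j₀ j₁ : Fin L, j₀ < j₁ ∧
    M 0 j₀ = 1 ∧ (∀ j, j < j₀ → M 0 j = 0) ∧
    M 1 j₁ = 1 ∧ (∀ j, j < j₁ → M 1 j = 0) ∧
    M 0 j₁ = 0

/-- The standard symplectic form `s(x,y) = Σ_{i=1}^n (x_{2i-1} y_{2i} - x_{2i} y_{2i-1})`
on `F^{2n}` (coordinates 0-indexed). -/
def sform {F : Type*} [Field F] (n : ℕ) (x y : Fin (2*n) → F) : F :=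
  ∑ i : Fin n,
    (x ⟨2*(i:ℕ), by have := i.isLt; omega⟩ * y ⟨2*(i:ℕ)+1, by have := i.isLt; omega⟩ -
     x ⟨2*(i:ℕ)+1, by have := i.isLt; omega⟩ * y ⟨2*(i:ℕ), by have := i.isLt; omega⟩)

/-- The rows of `G` span a totally isotropic 2-dimensional subspace of `F^{2n}`
for the standard symplectic form. -/
def TotIso {F : Type*} [Field F] (n : ℕ) (G : Matrix (Fin 2) (Fin (2*n)) F) : Prop :=
  Module.finrank F ↥(Submodule.span F ({G 0, G 1} : Set (Fin (2*n) → F))) = 2 ∧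
  ∀ u ∈ Submodule.span F ({G 0, G 1} : Set (Fin (2*n) → F)),
    ∀ v ∈ Submodule.span F ({G 0, G 1} : Set (Fin (2*n) → F)), sform n u v = 0

section Sform

variable {F : Type*} [Field F] {n : ℕ}

lemma sform_add_left (x x' y : Fin (2 * n) → F) :
    sform n (x + x') y = sform n x y + sform n x' y := by
  simp only [sform, ← Finset.sum_add_distrib, Pi.add_apply]
  exact Finset.sum_congr rfl fun i _ => by ring

lemma sform_smul_left (c : F) (x y : Fin (2 * n) → F) :
    sform n (c • x) y = c * sform n x y := by
  simp only [sform, Finset.mul_sum, Pi.smul_apply, smul_eq_mul]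
  exact Finset.sum_congr rfl fun i _ => by ring

lemma sform_swap (x y : Fin (2 * n) → F) : sform n x y = -sform n y x := by
  simp only [sform, ← Finset.sum_neg_distrib]
  exact Finset.sum_congr rfl fun i _ => by ring

lemma sform_self (x : Fin (2 * n) → F) : sform n x x = 0 :=
  Finset.sum_eq_zero fun i _ => by ring

lemma sform_add_right (x y y' : Fin (2 * n) → F) :
    sform n x (y + y') = sform n x y + sform n x y' := by
  rw [sform_swap, sform_add_left, sform_swap x y, sform_swap x y']; ring

lemma sform_smul_right (c : F) (x y : Fin (2 * n) → F) :
    sform n x (c • y) = c * sform n x y := by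
  rw [sform_swap, sform_smul_left, sform_swap x y]; ring

lemma sform_single_odd (i : Fin n) (y : Fin (2 * n) → F) :
    sform n (Pi.single ⟨2 * (i : ℕ) + 1, by omega⟩ 1) y = -y ⟨2 * (i : ℕ), by omega⟩ := by
  rw [sform, Finset.sum_eq_single i]
  · simp
  · intro k _ hk
    have h₁ : 2 * (k : ℕ) ≠ 2 * i + 1 := by omega
    have h₂ : (k : ℕ) ≠ i := fun h => hk (Fin.ext h)
    simp [h₁, h₂]
  · simp

lemma sform_single_even (i : Fin n) (y : Fin (2 * n) → F) :
    sform n (Pi.single ⟨2 * (i : ℕ), by omega⟩ 1) y = y ⟨2 * (i : ℕ) + 1, by omega⟩ := by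
  rw [sform, Finset.sum_eq_single i]
  · simp
  · intro k _ hk
    have h₁ : 2 * (k : ℕ) + 1 ≠ 2 * i := by omega
    have h₂ : (k : ℕ) ≠ i := fun h => hk (Fin.ext h)
    simp [h₁, h₂]
  · simp

/-- Every coordinate is, up to sign, the pairing with the basis vector at the partner
coordinate; the partner of a coordinate beyond an even index `t` is again beyond `t`. -/
lemma exists_partner {t : ℕ} (ht : Even t) (p : Fin (2 * n)) (hp : t ≤ p) :
    ∃ p' : Fin (2 * n), t ≤ p' ∧ p' ≠ p ∧
      ∃ ε : F, ε ≠ 0 ∧ ∀ y : Fin (2 * n) → F, sform n (Pi.single p' 1) y = ε * y p := by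
  obtain ⟨s, rfl⟩ := ht
  obtain ⟨p, hlt⟩ := p
  obtain ⟨k, rfl | rfl⟩ := Nat.even_or_odd' p
  · refine ⟨⟨2 * k + 1, by omega⟩, by simp at hp ⊢; omega, by simp, -1, by simp, fun y => ?_⟩
    rw [sform_single_odd ⟨k, by omega⟩ y]; ring
  · refine ⟨⟨2 * k, by omega⟩, by simp at hp ⊢; omega, by simp, 1, by simp, fun y => ?_⟩
    rw [sform_single_even ⟨k, by omega⟩ y]; ring

/-- For linearly independent rows, total isotropy is the vanishing of `s` on the two rows. -/
lemma totIso_iff (G : Matrix (Fin 2) (Fin (2 * n)) F) (hG : LinearIndependent F ![G 0, G 1]) :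
    TotIso n G ↔ sform n (G 0) (G 1) = 0 := by
  refine ⟨fun h => h.2 _ (Submodule.subset_span (by simp)) _ (Submodule.subset_span (by simp)),
    fun h => ⟨?_, fun u hu v hv => ?_⟩⟩
  · rw [← Matrix.range_cons_cons_empty (G 0) (G 1) ![], finrank_span_eq_card hG, Fintype.card_fin]
  · obtain ⟨a, b, rfl⟩ := Submodule.mem_span_pair.1 hu
    obtain ⟨c, d, rfl⟩ := Submodule.mem_span_pair.1 hv
    simp [sform_add_left, sform_add_right, sform_smul_left, sform_smul_right, sform_self,
      sform_swap (G 1) (G 0), h]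

end Sform

lemma linearIndependent_of_pivots {F : Type*} [Field F] {L : ℕ} {x y : Fin L → F} {i j : Fin L}
    (hx : x i = 1) (hy : y i = 0) (hyj : y j = 1) : LinearIndependent F ![x, y] := by
  rw [LinearIndependent.pair_iff]
  intro a b h
  have ha : a = 0 := by simpa [hx, hy] using congrFun h i
  subst ha
  exact ⟨rfl, by simpa [hyj] using congrFun h j⟩

lemma card_fiber_mul_card {F V W : Type*} [Field F] [AddCommGroup V] [Module F V]
    [AddCommGroup W] [Module F W] (f : V →ₗ[F] W) (hf : Function.Surjective f) (w : W) :
    Nat.card {v // f v = w} * Nat.card W = Nat.card V := by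
  obtain ⟨v₀, rfl⟩ := hf w
  have e : {v // f v = f v₀} ≃ LinearMap.ker f :=
    (Equiv.subRight v₀).subtypeEquiv fun v => by simp [sub_eq_zero]
  rw [Nat.card_congr e, ← Nat.card_congr (f.quotKerEquivOfSurjective hf).toEquiv,
    ← Submodule.card_eq_card_quotient_mul_card]

section Count

variable {F : Type*} [Field F] [Fintype F]

/-- The number of vectors with leading entry `1` in column `p`. -/
lemma card_pivot {L : ℕ} (p : Fin L) :
    Nat.card {y : Fin L → F // y p = 1 ∧ ∀ j, j < p → y j = 0} =
      Fintype.card F ^ (L - 1 - p) := by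
  classical
  have hsurj : Function.Surjective (LinearMap.funLeft F F (Subtype.val : {j // j ≤ p} → Fin L)) :=
    LinearMap.funLeft_surjective_of_injective _ _ _ Subtype.val_injective
  have h := card_fiber_mul_card _ hsurj (Pi.single ⟨p, le_rfl⟩ 1)
  have e : ∀ y : Fin L → F, LinearMap.funLeft F F (Subtype.val : {j // j ≤ p} → Fin L) y =
      Pi.single ⟨p, le_rfl⟩ 1 ↔ y p = 1 ∧ ∀ j, j < p → y j = 0 := by
    intro y
    simp only [funext_iff, LinearMap.funLeft_apply, Pi.single_apply, Subtype.forall,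
      Subtype.mk.injEq]
    refine ⟨fun h => ⟨by simpa using h p le_rfl, fun j hj => by
      simpa [hj.ne] using h j hj.le⟩, fun h j hj => ?_⟩
    split_ifs with hjp
    · rw [hjp, h.1]
    · exact h.2 j (lt_of_le_of_ne hj hjp)
  rw [Nat.card_congr (Equiv.subtypeEquivRight e)] at h
  have hq : 0 < Fintype.card F := Fintype.card_pos
  have hc : Fintype.card {j // j ≤ p} = p + 1 := by
    rw [Fintype.card_subtype, show Finset.univ.filter (· ≤ p) = Finset.Iic p by ext; simp, Fin.card_Iic]
  simp only [Nat.card_eq_fintype_card, Fintype.card_fun, Fintype.card_fin, hc] at h ⊢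
  refine Nat.eq_of_mul_eq_mul_right (pow_pos hq (p + 1)) (h.trans ?_)
  rw [← pow_add]
  congr 1
  omega

/-- The number of first rows with prescribed first `t` entries that vanish in the pivot column
of the second row `y` and are orthogonal to `y`. -/
lemma card_orthogonal {n t : ℕ} (htn : t ≤ 2 * n) (ht : Even t) (A : Fin t → F)
    (p : Fin (2 * n)) (hp : t ≤ p) (y : Fin (2 * n) → F) (hy : y p = 1) :
    Nat.card {x : Fin (2 * n) → F //
      (∀ j : Fin t, x (Fin.castLE htn j) = A j) ∧ x p = 0 ∧ sform n x y = 0} =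
      Fintype.card F ^ (2 * n - t - 2) := by
  classical
  obtain ⟨p', hp', hne, ε, hε, hs⟩ := exists_partner (F := F) ht p hp
  let f : (Fin (2 * n) → F) →ₗ[F] (Fin t → F) × F × F :=
    (LinearMap.funLeft F F (Fin.castLE htn)).prod ((LinearMap.proj p).prod
      { toFun := fun x => sform n x y
        map_add' := fun x x' => sform_add_left x x' y
        map_smul' := fun c x => sform_smul_left c x y })
  have hfx : ∀ x, f x = (fun j => x (Fin.castLE htn j), x p, sform n x y) := fun _ => rfl
  have hf : Function.Surjective f := by
    rintro ⟨a, b, c⟩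
    obtain ⟨x₀, hx₀⟩ :=
      LinearMap.funLeft_surjective_of_injective F F _ (Fin.castLE_injective htn) a
    have hlt : ∀ (j : Fin t) (r : Fin (2 * n)), t ≤ r → Fin.castLE htn j ≠ r := by
      rintro j r hr rfl
      have := j.isLt
      simp at hr
      omega
    set x₁ := x₀ + (b - x₀ p) • (Pi.single p 1 : Fin (2 * n) → F) with hx₁
    refine ⟨x₁ + ((c - sform n x₁ y) / ε) • (Pi.single p' 1 : Fin (2 * n) → F), ?_⟩
    rw [hfx]
    refine Prod.ext ?_ (Prod.ext ?_ ?_)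
    · funext j
      simpa [hx₁, Pi.single_apply, hlt j p hp, hlt j p' hp'] using congrFun hx₀ j
    · simp [hx₁, hne.symm]
    · simp only [sform_add_left _ _ y, sform_smul_left, hs, hy]
      field_simp
      ring
  have h := card_fiber_mul_card f hf (A, 0, 0)
  have e : ∀ x, f x = (A, 0, 0) ↔
      (∀ j : Fin t, x (Fin.castLE htn j) = A j) ∧ x p = 0 ∧ sform n x y = 0 := by
    intro x
    simp [hfx, funext_iff]
  rw [Nat.card_congr (Equiv.subtypeEquivRight e)] at h
  have hq : 0 < Fintype.card F := Fintype.card_pos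
  simp only [Nat.card_eq_fintype_card, Fintype.card_fun, Fintype.card_fin, Fintype.card_prod] at h ⊢
  refine Nat.eq_of_mul_eq_mul_right (pow_pos hq (t + 2)) ?_
  have hlt : t + 2 ≤ 2 * n := by
    have := p.isLt
    have := p'.isLt
    have : (p' : ℕ) ≠ p := fun h => hne (Fin.ext h)
    omega
  rw [← pow_add, show 2 * n - t - 2 + (t + 2) = 2 * n by omega, ← h]
  ring

end Count

/-- A matrix whose first `t` columns are given by a normalized nonzero first row and a zero second
row is in reduced echelon form with totally isotropic row space iff its second row has a pivot
beyond column `t` above which the first row vanishes, and its rows are orthogonal. -/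
lemma isRREF2_totIso_iff {F : Type*} [Field F] {n t : ℕ} (htn : t ≤ 2 * n) {A : Fin t → F}
    (hA : ∃ j : Fin t, A j = 1 ∧ ∀ k, k < j → A k = 0) (G : Matrix (Fin 2) (Fin (2 * n)) F) :
    (IsRREF2 G ∧ (∀ j : Fin t, G 0 (Fin.castLE htn j) = A j ∧ G 1 (Fin.castLE htn j) = 0) ∧
      TotIso n G) ↔
    ∃ p : Fin (2 * n), (t ≤ (p : ℕ) ∧ G 1 p = 1 ∧ ∀ j, j < p → G 1 j = 0) ∧
      (∀ j : Fin t, G 0 (Fin.castLE htn j) = A j) ∧ G 0 p = 0 ∧ sform n (G 0) (G 1) = 0 := by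
  obtain ⟨j, hj, hlt⟩ := hA
  constructor
  · rintro ⟨⟨j₀, p, hjp, h0, -, h1, hz, h0p⟩, hcols, hiso⟩
    refine ⟨p, ⟨?_, h1, hz⟩, fun j => (hcols j).1, h0p, ?_⟩
    · by_contra! hp
      have h := (hcols ⟨p, hp⟩).2
      rw [show Fin.castLE htn ⟨p, hp⟩ = p from rfl, h1] at h
      exact one_ne_zero h
    · exact (totIso_iff G (linearIndependent_of_pivots h0 (hz _ hjp) h1)).1 hiso
  · rintro ⟨p, ⟨hp, h1, hz⟩, hcols, h0p, hs⟩
    have hbelow : ∀ j : Fin t, Fin.castLE htn j < p := fun j => by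
      have := j.isLt
      rw [Fin.lt_def, Fin.val_castLE]
      omega
    refine ⟨⟨Fin.castLE htn j, p, hbelow j, by rw [hcols, hj], fun k hk => ?_, h1, hz, h0p⟩,
      fun j => ⟨hcols j, hz _ (hbelow j)⟩, ?_⟩
    · have hkj : (k : ℕ) < j := hk
      rw [← hlt ⟨k, hkj.trans j.isLt⟩ hkj, ← hcols]
      rfl
    · exact (totIso_iff G (linearIndependent_of_pivots ((hcols j).trans hj)
        (hz _ (hbelow j)) h1)).2 hs

lemma sum_pow_tail (q L t : ℕ) (hq : 2 ≤ q) :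
    (∑ p : Fin L, if t ≤ (p : ℕ) then q ^ (L - 1 - p) else 0) = (q ^ (L - t) - 1) / (q - 1) := by
  rw [Fin.sum_univ_eq_sum_range (fun p => if t ≤ p then q ^ (L - 1 - p) else 0),
    ← Finset.sum_filter, show (Finset.range L).filter (t ≤ ·) = Finset.Ico t L by
      ext; simp [and_comm], Finset.sum_Ico_eq_sum_range, ← Nat.geomSum_eq hq,
    ← Finset.sum_range_reflect]
  refine Finset.sum_congr rfl fun k hk => ?_
  rw [Finset.mem_range] at hk
  congr 1
  omega

theorem stmt19 (q n t : ℕ) (hn : 2 ≤ n) (ht2 : 2 ≤ t) (htn : t ≤ 2*n - 2)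
    (hteven : Even t) (F : Type*) [Field F] [Fintype F] (hq : Fintype.card F = q)
    (A : Fin t → F) (hA : ∃ j : Fin t, A j = 1 ∧ ∀ k, k < j → A k = 0) :
    Nat.card {G : Matrix (Fin 2) (Fin (2*n)) F //
        IsRREF2 G ∧
        (∀ j : Fin t, G 0 (Fin.castLE (by omega) j) = A j ∧
                      G 1 (Fin.castLE (by omega) j) = 0) ∧
        TotIso n G}
      = q ^ (2*n - t - 2) * (q ^ (2*n - t) - 1) / (q - 1) := by
  classical
  subst hq
  have htn' : t ≤ 2 * n := by omega
  have hq2 : 2 ≤ Fintype.card F := Fintype.one_lt_card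
  let P : Fin (2 * n) → (Fin (2 * n) → F) → Prop := fun p y =>
    t ≤ (p : ℕ) ∧ y p = 1 ∧ ∀ j, j < p → y j = 0
  let Q : Fin (2 * n) → (Fin (2 * n) → F) → (Fin (2 * n) → F) → Prop := fun p y x =>
    (∀ j : Fin t, x (Fin.castLE htn' j) = A j) ∧ x p = 0 ∧ sform n x y = 0
  rw [Nat.card_congr (Equiv.subtypeEquivRight (isRREF2_totIso_iff htn' hA))]
  let φ : {z : Fin (2 * n) × (Fin (2 * n) → F) × (Fin (2 * n) → F) //
      P z.1 z.2.1 ∧ Q z.1 z.2.1 z.2.2} →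
      {G : Matrix (Fin 2) (Fin (2 * n)) F // ∃ p, P p (G 1) ∧ Q p (G 1) (G 0)} :=
    fun z => ⟨![z.1.2.2, z.1.2.1], z.1.1, z.2⟩
  have hφ : Function.Bijective φ := by
    constructor
    · intro z z' h
      obtain ⟨⟨p, y, x⟩, ⟨hpt, hp, hpz⟩, hQ⟩ := z
      obtain ⟨⟨p', y', x'⟩, ⟨hpt', hp', hpz'⟩, hQ'⟩ := z'
      have hG : (![x, y] : Fin 2 → Fin (2 * n) → F) = ![x', y'] := congrArg Subtype.val h
      obtain rfl : x = x' := congrFun hG 0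
      obtain rfl : y = y' := congrFun hG 1
      have hpp : p = p' := by
        rcases lt_trichotomy p p' with hlt | heq | hlt
        · exact absurd (hp.symm.trans (hpz' p hlt)) one_ne_zero
        · exact heq
        · exact absurd (hp'.symm.trans (hpz p' hlt)) one_ne_zero
      subst hpp
      rfl
    · rintro ⟨G, p, hG⟩
      refine ⟨⟨(p, G 1, G 0), hG⟩, Subtype.ext ?_⟩
      funext i
      fin_cases i <;> rfl
  change Nat.card {G : Matrix (Fin 2) (Fin (2 * n)) F // ∃ p, P p (G 1) ∧ Q p (G 1) (G 0)} = _
  rw [← Nat.card_congr (Equiv.ofBijective φ hφ), Nat.card_eq_fintype_card, Fintype.card_subtype,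
    Finset.card_filter, Fintype.sum_prod_type]
  simp only [Fintype.sum_prod_type]
  have hQ : ∀ p y, (∑ x, if P p y ∧ Q p y x then 1 else 0) =
      if P p y then Fintype.card F ^ (2 * n - t - 2) else 0 := by
    intro p y
    by_cases h : P p y
    · simp only [h, true_and, if_true]
      rw [← card_orthogonal htn' hteven A p h.1 y h.2.1, Nat.card_eq_fintype_card,
        Fintype.card_subtype, Finset.card_filter]
    · simp [h]
  have hP : ∀ p, (∑ y, if P p y then Fintype.card F ^ (2 * n - t - 2) else 0) =
      Fintype.card F ^ (2 * n - t - 2) *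
        if t ≤ (p : ℕ) then Fintype.card F ^ (2 * n - 1 - p) else 0 := by
    intro p
    by_cases h : t ≤ (p : ℕ)
    · rw [if_pos h, ← card_pivot (F := F) p, Nat.card_eq_fintype_card, Fintype.card_subtype,
        Finset.card_filter, Finset.mul_sum]
      simp [P, h]
    · simp [P, h]
  simp only [hQ, hP]
  rw [← Finset.mul_sum, sum_pow_tail _ _ _ hq2, Nat.mul_div_assoc]
  simpa using Nat.sub_dvd_pow_sub_pow (Fintype.card F) 1 (2 * n - t)
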